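/- Fix an alternative a ∈ A and let f be a strategyproof and ex post efficient SDS on a super Condorcet domain D (i.e., D_C ⊆ D). Then there exist a random dictatorship d and a real number γ (with 1 − γ ≥ 0 not required, γ may satisfy 1 − γ < 0 in general, but d = Σ_i γ_i d_i with γ_i ≥ 0) such that f(R) = (1 − γ)·COND(R) + γ·d(R) for all profiles R ∈ D_C^a; equivalently, there are a constant γ_C ∈ ℝ and constants γ_i ≥ 0 for each voter i with γ_C + Σ_i γ_i = 1 such that f(R) = γ_C·COND(R) + Σ_i γ_i·d_i(R) for all R ∈ D_C^a. -/

import Mathlib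

open scoped Classical
open Finset

/-- A preference relation: a complete, transitive, and antisymmetric binary relation. -/
def IsPref {A : Type*} (r : A → A → Prop) : Prop :=
  (∀ x y : A, x ≠ y → r x y ∨ r y x) ∧
  (∀ x y z : A, r x y → r y z → r x z) ∧
  (∀ x y : A, r x y → ¬ r y x)

/-- A preference profile for `n` voters over alternatives `A`. -/
abbrev Prof (n : ℕ) (A : Type*) := Fin n → A → A → Prop

/-- Every voter's relation is a preference relation. -/
def IsProf {n : ℕ} {A : Type*} (R : Prof n A) : Prop := ∀ i, IsPref (R i)

/-- The majority margin `g_R(x,y)`. -/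
noncomputable def margin {n : ℕ} {A : Type*} (R : Prof n A) (x y : A) : ℤ :=
  (Nat.card {i : Fin n // R i x y} : ℤ) - (Nat.card {i : Fin n // R i y x} : ℤ)

/-- `x` is the Condorcet winner of `R`. -/
def CondorcetWinner {n : ℕ} {A : Type*} (R : Prof n A) (x : A) : Prop :=
  ∀ y, y ≠ x → 0 < margin R x y

/-- The Condorcet domain: all profiles admitting a Condorcet winner. -/
def CondorcetDomain (n : ℕ) (A : Type*) : Set (Prof n A) :=
  {R | IsProf R ∧ ∃ x, CondorcetWinner R x}

/-- The `(n+1)`-voter profile `(R, ▷)` obtained from `R` by adding `t` as an extra voter. -/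
def tieProf {n : ℕ} {A : Type*} (R : Prof n A) (t : A → A → Prop) : Prof (n + 1) A :=
  Fin.cons t R

/-- The tie-breaking Condorcet domain `D_C^▷`. -/
def TieCondorcetDomain (n : ℕ) {A : Type*} (t : A → A → Prop) : Set (Prof n A) :=
  {R | IsProf R ∧ ∃ x, CondorcetWinner (tieProf R t) x}

/-- Upper contour set `U(≻, x)`. -/
def UC {A : Type*} (r : A → A → Prop) (x : A) : Set A := {y | r y x ∨ y = x}

/-- Probability that the lottery `p` assigns to the set `S`. -/
noncomputable def mass {A : Type*} [Fintype A] (p : A → ℝ) (S : Set A) : ℝ :=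
  ∑ y, S.indicator p y

/-- Stochastic dominance `p ≿^SD q` w.r.t. the preference relation `r`. -/
def SDdom {A : Type*} [Fintype A] (r : A → A → Prop) (p q : A → ℝ) : Prop :=
  ∀ x, mass q (UC r x) ≤ mass p (UC r x)

/-- `f` is a social decision scheme on the domain `D`: on `D` it returns lotteries. -/
def IsSDS {n : ℕ} {A : Type*} [Fintype A] (D : Set (Prof n A))
    (f : Prof n A → A → ℝ) : Prop :=
  ∀ R ∈ D, (∀ x, 0 ≤ f R x) ∧ (∑ x, f R x) = 1

/-- Strategyproofness of `f` on `D`. -/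
def Strategyproof {n : ℕ} {A : Type*} [Fintype A] (D : Set (Prof n A))
    (f : Prof n A → A → ℝ) : Prop :=
  ∀ R ∈ D, ∀ R' ∈ D, ∀ i : Fin n,
    (∀ j, j ≠ i → R j = R' j) → SDdom (R i) (f R) (f R')

/-- Group-strategyproofness of `f` on `D`. -/
def GroupStrategyproof {n : ℕ} {A : Type*} [Fintype A] (D : Set (Prof n A))
    (f : Prof n A → A → ℝ) : Prop :=
  ∀ R ∈ D, ∀ R' ∈ D, ∀ I : Finset (Fin n), I.Nonempty →
    (∀ j ∉ I, R j = R' j) → ∃ i ∈ I, SDdom (R i) (f R) (f R')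

/-- Non-imposition of `f` on `D`. -/
def NonImposing {n : ℕ} {A : Type*} [Fintype A] (D : Set (Prof n A))
    (f : Prof n A → A → ℝ) : Prop :=
  ∀ x : A, ∃ R ∈ D, f R x = 1

/-- Ex post efficiency of `f` on `D`. -/
def ExPostEfficient {n : ℕ} {A : Type*} [Fintype A] (D : Set (Prof n A))
    (f : Prof n A → A → ℝ) : Prop :=
  ∀ R ∈ D, ∀ x y : A, (∀ i, R i x y) → f R y = 0

/-- `x` is top-ranked by the preference relation `r`. -/
def TopRanked {A : Type*} (r : A → A → Prop) (x : A) : Prop := ∀ y, y ≠ x → r x y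

/-- The dictatorship of voter `i`. -/
noncomputable def dict {n : ℕ} {A : Type*} [Fintype A] (i : Fin n) (R : Prof n A) : A → ℝ :=
  fun x => if TopRanked (R i) x then 1 else 0

/-- The Condorcet rule `COND`. -/
noncomputable def CondRule {n : ℕ} {A : Type*} [Fintype A] : Prof n A → A → ℝ :=
  fun R x => if CondorcetWinner R x then 1 else 0

/-- The tie-breaking Condorcet rule `COND^▷`. -/
noncomputable def TieCondRule {n : ℕ} {A : Type*} [Fintype A] (t : A → A → Prop) :
    Prof n A → A → ℝ :=
  fun R x => if CondorcetWinner (tieProf R t) x then 1 else 0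

/-- The relation obtained from `r` by swapping the (adjacent) alternatives `x ≻ y`. -/
def swapRel {A : Type*} (r : A → A → Prop) (x y : A) : A → A → Prop :=
  fun a b => (a = y ∧ b = x) ∨ (r a b ∧ ¬(a = x ∧ b = y))

/-- `R'` arises from `R` by letting voter `i` swap the adjacent alternatives `x ≻_i y`,
i.e., `R' = R^{i:yx}`. -/
def AdjSwap {n : ℕ} {A : Type*} (R R' : Prof n A) (i : Fin n) (x y : A) : Prop :=
  x ≠ y ∧ R i x y ∧ (∀ z, z ≠ x → z ≠ y → ¬(R i x z ∧ R i z y)) ∧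
  R' i = swapRel (R i) x y ∧ (∀ j, j ≠ i → R' j = R j)

/-- A single ad-path step inside `D`. -/
def Step {n : ℕ} {A : Type*} (D : Set (Prof n A)) (R R' : Prof n A) : Prop :=
  R ∈ D ∧ R' ∈ D ∧ ∃ i x y, AdjSwap R R' i x y

/-- A single ad-path step inside `D` in which the alternative `a` is not swapped. -/
def StepAvoiding {n : ℕ} {A : Type*} (D : Set (Prof n A)) (a : A) (R R' : Prof n A) : Prop :=
  R ∈ D ∧ R' ∈ D ∧ ∃ i x y, AdjSwap R R' i x y ∧ x ≠ a ∧ y ≠ a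

/-- There is an ad-path from `R` to `R'` inside `D`. -/
def AdPath {n : ℕ} {A : Type*} (D : Set (Prof n A)) (R R' : Prof n A) : Prop :=
  R ∈ D ∧ R' ∈ D ∧ Relation.ReflTransGen (Step D) R R'

/-- There is an ad-path from `R` to `R'` inside `D` along which `a` is never swapped. -/
def AdPathAvoiding {n : ℕ} {A : Type*} (D : Set (Prof n A)) (a : A) (R R' : Prof n A) : Prop :=
  R ∈ D ∧ R' ∈ D ∧ Relation.ReflTransGen (StepAvoiding D a) R R'

/-- `D` is weakly connected. -/
def WeaklyConnected {n : ℕ} {A : Type*} (D : Set (Prof n A)) : Prop :=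
  ∀ R ∈ D, ∀ R' ∈ D, AdPath D R R'

/-- `D` is connected. -/
def Connected {n : ℕ} {A : Type*} (D : Set (Prof n A)) : Prop :=
  WeaklyConnected D ∧
  ∀ a : A, ∀ R ∈ D, ∀ R' ∈ D, (∀ i, UC (R i) a = UC (R' i) a) → AdPathAvoiding D a R R'

section PreferenceRelations

variable {A : Type*} {r : A → A → Prop} {S : Set A}

/-- `S` is closed under passing to better alternatives. -/
def UpClosed (r : A → A → Prop) (S : Set A) : Prop := ∀ p ∈ S, ∀ q, r q p → q ∈ S

/-- Move the alternatives in `S` to the top, keeping the order inside `S` and inside `Sᶜ`. -/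
def liftSet (S : Set A) (r : A → A → Prop) : A → A → Prop :=
  fun p q => (p ∈ S ∧ q ∉ S) ∨ ((p ∈ S ↔ q ∈ S) ∧ r p q)

lemma IsPref.irrefl (hr : IsPref r) (x : A) : ¬ r x x := fun h => hr.2.2 x x h h

lemma IsPref.liftSet (hr : IsPref r) (S : Set A) : IsPref (liftSet S r) := by
  refine ⟨fun x y hxy => ?_, fun x y z hxy hyz => ?_, fun x y hxy hyx => ?_⟩
  · have := hr.1 x y hxy
    unfold _root_.liftSet; tauto
  · have := hr.2.1 x y z
    unfold _root_.liftSet at *; tauto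
  · have := hr.2.2 x y
    unfold _root_.liftSet at *; tauto

lemma IsPref.exists_finite [Finite A] : ∃ r : A → A → Prop, IsPref r := by
  obtain ⟨k, ⟨e⟩⟩ := Finite.exists_equiv_fin A
  refine ⟨fun x y => e x < e y, fun x y hxy => ?_, fun x y z => lt_trans, fun x y => lt_asymm⟩
  exact lt_or_gt_of_ne fun h => hxy (e.injective h)

lemma IsPref.topRanked_unique (hr : IsPref r) {x y : A} (hx : TopRanked r x)
    (hy : TopRanked r y) : x = y := by
  by_contra h
  exact hr.2.2 x y (hx y (Ne.symm h)) (hy x h)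

lemma topRanked_iff (hr : IsPref r) {x : A} : TopRanked r x ↔ ∀ y, ¬ r y x := by
  refine ⟨fun h y hy => ?_, fun h y hy => (hr.1 y x hy).resolve_left (h y)⟩
  by_cases hyx : y = x
  · exact hr.irrefl x (hyx ▸ hy)
  · exact hr.2.2 _ _ hy (h y hyx)

lemma topRanked_congr {r' : A → A → Prop} (hr : IsPref r) (hr' : IsPref r') {x : A}
    (h : ∀ w, r w x ↔ r' w x) : TopRanked r x ↔ TopRanked r' x := by
  simp [topRanked_iff hr, topRanked_iff hr', h]

lemma TopRanked.liftSet {a : A} (ha : TopRanked r a) (h : a ∈ S) : TopRanked (liftSet S r) a := by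
  intro y hy
  have := ha y hy
  unfold _root_.liftSet; tauto

lemma topRanked_liftSet_singleton (r : A → A → Prop) (a : A) :
    TopRanked (liftSet {a} r) a := fun _ hy => Or.inl ⟨rfl, hy⟩

lemma IsPref.exists_least [Finite A] (hr : IsPref r) (hS : S.Nonempty) :
    ∃ x ∈ S, ∀ y ∈ S, y ≠ x → r y x := by
  have : IsTrans A (fun p q => r q p) := ⟨fun p q s hpq hqs => hr.2.1 _ _ _ hqs hpq⟩
  have : Std.Irrefl (fun p q : A => r q p) := ⟨fun p => hr.irrefl p⟩
  obtain ⟨x, hx, hmin⟩ := (Finite.wellFounded_of_trans_of_irrefl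
    (fun p q : A => r q p)).has_min S hS
  exact ⟨x, hx, fun y hy hyx => (hr.1 y x hyx).resolve_right (hmin y hy)⟩

lemma IsPref.exists_topRanked [Finite A] [Nonempty A] (hr : IsPref r) : ∃ x, TopRanked r x := by
  have hr' : IsPref (fun x y => r y x) :=
    ⟨fun x y h => (hr.1 x y h).symm, fun x y z hxy hyz => hr.2.1 _ _ _ hyz hxy,
      fun x y => hr.2.2 y x⟩
  obtain ⟨x, -, hx⟩ := hr'.exists_least (S := Set.univ) Set.univ_nonempty
  exact ⟨x, fun y hy => hx y trivial hy⟩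

lemma IsPref.upClosed_above (hr : IsPref r) (x : A) : UpClosed r {w | r w x} :=
  fun p hp q hq => hr.2.1 q p x hq hp

lemma IsPref.upClosed_insert_above (hr : IsPref r) (x : A) :
    UpClosed r (insert x {w | r w x}) := by
  rintro p (rfl | hp) q hq
  · exact Or.inr hq
  · exact Or.inr (hr.2.1 q p x hq hp)

lemma UpClosed.eq_UC [Finite A] (hr : IsPref r) (hS : UpClosed r S) (hne : S.Nonempty) :
    ∃ x, S = UC r x := by
  obtain ⟨x, hx, hmin⟩ := hr.exists_least hne
  refine ⟨x, Set.ext fun y => ⟨fun hy => ?_, ?_⟩⟩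
  · by_cases h : y = x
    · exact Or.inr h
    · exact Or.inl (hmin y hy h)
  · rintro (h | rfl)
    · exact hS x hx y h
    · exact hx

lemma mass_insert [Fintype A] (p : A → ℝ) {x : A} (hx : x ∉ S) :
    mass p (insert x S) = p x + mass p S := by
  have h : ∀ y, (insert x S).indicator p y = (if y = x then p x else 0) + S.indicator p y := by
    intro y
    by_cases hy : y = x
    · subst hy; simp [hx]
    · by_cases hyS : y ∈ S <;> simp [hy, hyS]
  simp [mass, h, Finset.sum_add_distrib]

end PreferenceRelations

section Profiles

variable {n : ℕ} {A : Type*} {R R' : Prof n A} {a : A}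

/-- The profiles in which `a` is the Condorcet winner. -/
def WinnerDomain (n : ℕ) {A : Type*} (a : A) : Set (Prof n A) :=
  {R | IsProf R ∧ CondorcetWinner R a}

lemma WinnerDomain.isProf : ∀ R ∈ WinnerDomain n a, IsProf R := fun _ h => h.1

lemma margin_pos_iff (R : Prof n A) (x y : A) :
    0 < margin R x y ↔ Nat.card {i // R i y x} < Nat.card {i // R i x y} := by
  unfold margin; omega

lemma IsProf.update (hR : IsProf R) {r : A → A → Prop} (hr : IsPref r) (i : Fin n) :
    IsProf (Function.update R i r) := by
  intro j
  by_cases h : j = i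
  · subst h; simpa using hr
  · simpa [h] using hR j

lemma condorcetWinner_unique {x y : A} (hx : CondorcetWinner R x) (hy : CondorcetWinner R y) :
    x = y := by
  by_contra h
  have h₁ := hx y (Ne.symm h)
  have h₂ := hy x h
  rw [margin_pos_iff] at h₁ h₂
  omega

lemma card_subtype_mono {p q : Fin n → Prop} (h : ∀ i, p i → q i) :
    Nat.card {i // p i} ≤ Nat.card {i // q i} :=
  Nat.card_le_card_of_injective (Subtype.map id h) (Subtype.map_injective h Function.injective_id)

/-- `a` stays the Condorcet winner if for each `y` its supporters against `y` include its former
supporters against some alternative. -/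
lemma mem_winnerDomain_of_support (hR : R ∈ WinnerDomain n a) (hR' : IsProf R')
    (h : ∀ y, y ≠ a → ∃ x, x ≠ a ∧ ∀ j, R j a x → R' j a y) : R' ∈ WinnerDomain n a := by
  refine ⟨hR', fun y hy => ?_⟩
  obtain ⟨x, hx, hxy⟩ := h y hy
  have h₁ := hR.2 x hx
  rw [margin_pos_iff] at h₁ ⊢
  have h₂ := card_subtype_mono hxy
  have h₃ : Nat.card {i // R' i y a} ≤ Nat.card {i // R i x a} :=
    card_subtype_mono fun j hj => ((hR.1 j).1 x a hx).resolve_right fun hax =>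
      (hR' j).2.2 _ _ hj (hxy j hax)
  omega

lemma mem_winnerDomain_of_raise (hR : R ∈ WinnerDomain n a) (hR' : IsProf R')
    (h : ∀ j y, R j a y → R' j a y) : R' ∈ WinnerDomain n a :=
  mem_winnerDomain_of_support hR hR' fun y hy => ⟨y, hy, fun j => h j y⟩

lemma mem_winnerDomain_of_topRanked (hn : 3 ≤ n) (hR : IsProf R) (i : Fin n)
    (h : ∀ j, j ≠ i → TopRanked (R j) a) : R ∈ WinnerDomain n a := by
  refine ⟨hR, fun y hy => ?_⟩
  rw [margin_pos_iff]
  have h₁ : Nat.card {j // R j y a} ≤ Nat.card {j // j = i} :=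
    card_subtype_mono fun j hj => by
      by_contra hji
      exact (hR j).2.2 _ _ hj (h j hji y hy)
  have h₂ : Nat.card {j // j ≠ i} ≤ Nat.card {j // R j a y} :=
    card_subtype_mono fun j hj => h j hj y hy
  have h₃ : Nat.card {j // j = i} = 1 := by simp
  have h₄ : Nat.card {j // j ≠ i} = n - 1 := by
    simp [Nat.card_eq_fintype_card, Fintype.card_subtype_compl]
  omega

/-- A quantity unchanged when voters switch one by one from `R` to `R'` agrees on `R` and `R'`. -/
lemma eq_of_switch_one_by_one {β : Type*} (g : Prof n A → β) (R R' : Prof n A)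
    (h : ∀ (Q : Prof n A) (i : Fin n), (∀ j, Q j = R j ∨ Q j = R' j) → Q i = R i →
      g Q = g (Function.update Q i (R' i))) : g R = g R' := by
  have key : ∀ s : Finset (Fin n), g R = g (fun j => if j ∈ s then R' j else R j) := by
    intro s
    induction s using Finset.induction_on with
    | empty => simp
    | insert i s hi ih =>
      rw [ih, h _ i (fun j => by by_cases hj : j ∈ s <;> simp [hj]) (by simp [hi])]
      congr 1
      funext j
      by_cases hj : j = i
      · subst hj; simp
      · simp [hj]
  simpa using key Finset.univ

end Profiles

section Strategyproofness

variable {n : ℕ} {A : Type*} [Fintype A] {R R' : Prof n A} {i : Fin n} {D : Set (Prof n A)}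
  {f : Prof n A → A → ℝ}

lemma Strategyproof.mass_le (hD : ∀ R ∈ D, IsProf R) (hsp : Strategyproof D f) (hR : R ∈ D)
    (hR' : R' ∈ D) (h : ∀ j, j ≠ i → R j = R' j) {S : Set A} (hS : UpClosed (R i) S) :
    mass (f R') S ≤ mass (f R) S := by
  rcases S.eq_empty_or_nonempty with rfl | hne
  · simp [mass]
  · obtain ⟨x, rfl⟩ := hS.eq_UC (hD R hR i) hne
    exact hsp R hR R' hR' i h x

lemma Strategyproof.mass_eq (hD : ∀ R ∈ D, IsProf R) (hsp : Strategyproof D f) (hR : R ∈ D)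
    (hR' : R' ∈ D) (h : ∀ j, j ≠ i → R j = R' j) {S : Set A} (hS : UpClosed (R i) S)
    (hS' : UpClosed (R' i) S) : mass (f R) S = mass (f R') S :=
  le_antisymm (hsp.mass_le hD hR' hR (fun j hj => (h j hj).symm) hS')
    (hsp.mass_le hD hR hR' h hS)

lemma Strategyproof.apply_eq (hD : ∀ R ∈ D, IsProf R) (hsp : Strategyproof D f) (hR : R ∈ D)
    (hR' : R' ∈ D) (h : ∀ j, j ≠ i → R j = R' j) {x : A} (hx : ∀ w, R i w x ↔ R' i w x) :
    f R x = f R' x := by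
  have hS : {w | R' i w x} = {w | R i w x} := Set.ext fun w => (hx w).symm
  have h₁ := hsp.mass_eq hD hR hR' h ((hD R hR i).upClosed_above x)
    (hS ▸ (hD R' hR' i).upClosed_above x)
  have h₂ := hsp.mass_eq hD hR hR' h ((hD R hR i).upClosed_insert_above x)
    (hS ▸ (hD R' hR' i).upClosed_insert_above x)
  have hx' : x ∉ {w | R i w x} := (hD R hR i).irrefl x
  rw [mass_insert _ hx', mass_insert _ hx'] at h₂
  linarith

lemma Strategyproof.apply_add_apply_eq (hD : ∀ R ∈ D, IsProf R) (hsp : Strategyproof D f)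
    (hR : R ∈ D) (hR' : R' ∈ D) (h : ∀ j, j ≠ i → R j = R' j) {S : Set A} {x z : A}
    (hxz : x ≠ z) (hxS : x ∉ S) (hzS : z ∉ S) (h₁ : UpClosed (R i) S)
    (h₁' : UpClosed (R' i) S) (h₂ : UpClosed (R i) (insert x (insert z S)))
    (h₂' : UpClosed (R' i) (insert x (insert z S))) :
    f R x + f R z = f R' x + f R' z := by
  have e₁ := hsp.mass_eq hD hR hR' h h₁ h₁'
  have e₂ := hsp.mass_eq hD hR hR' h h₂ h₂'
  have hx' : x ∉ insert z S := by simp [hxz, hxS]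
  rw [mass_insert _ hx', mass_insert _ hx', mass_insert _ hzS, mass_insert _ hzS] at e₂
  linarith

end Strategyproofness

section SwapConstruction

variable {A : Type*} {r : A → A → Prop} {x z : A}

/-- Move `z` directly below `x`. -/
def belowRel (r : A → A → Prop) (x z : A) : A → A → Prop :=
  liftSet (insert x (insert z {w | r w x})) r

/-- Move `z` directly above `x`. -/
def aboveRel (r : A → A → Prop) (x z : A) : A → A → Prop :=
  liftSet (insert z {w | r w x}) r

lemma IsPref.belowRel (hr : IsPref r) (x z : A) : IsPref (belowRel r x z) := hr.liftSet _

lemma IsPref.aboveRel (hr : IsPref r) (x z : A) : IsPref (aboveRel r x z) := hr.liftSet _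

lemma TopRanked.belowRel {a : A} (ha : TopRanked r a) (h : r a x) :
    TopRanked (belowRel r x z) a := ha.liftSet (Or.inr (Or.inr h))

lemma TopRanked.aboveRel {a : A} (ha : TopRanked r a) (h : r a x) :
    TopRanked (aboveRel r x z) a := ha.liftSet (Or.inr h)

lemma belowRel_apply_iff (hr : IsPref r) (hxz : r x z) (w : A) :
    belowRel r x z w x ↔ r w x := by
  have := hr.2.2 x z hxz
  have := hr.irrefl x
  simp only [belowRel, liftSet, Set.mem_insert_iff, Set.mem_ofPred_eq]
  grind

lemma aboveRel_apply (hr : IsPref r) (hxz : r x z) : aboveRel r x z z x := by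
  refine Or.inl ⟨Or.inl rfl, ?_⟩
  rintro (rfl | h)
  exacts [hr.irrefl _ hxz, hr.irrefl _ h]

lemma upClosed_above_belowRel (hr : IsPref r) :
    UpClosed (belowRel r x z) {w | r w x} := by
  have := hr.2.1
  have := hr.2.2
  have := hr.irrefl
  simp only [UpClosed, belowRel, liftSet, Set.mem_insert_iff, Set.mem_ofPred_eq]
  grind

lemma upClosed_above_aboveRel (hr : IsPref r) :
    UpClosed (aboveRel r x z) {w | r w x} := by
  have := hr.2.1
  have := hr.2.2
  have := hr.irrefl
  simp only [UpClosed, aboveRel, liftSet, Set.mem_insert_iff, Set.mem_ofPred_eq]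
  grind

lemma upClosed_liftSet (S : Set A) (r : A → A → Prop) : UpClosed (liftSet S r) S := by
  unfold UpClosed liftSet
  tauto

lemma upClosed_pair_belowRel (r : A → A → Prop) (x z : A) :
    UpClosed (belowRel r x z) (insert x (insert z {w | r w x})) := upClosed_liftSet _ r

lemma upClosed_pair_aboveRel (hr : IsPref r) :
    UpClosed (aboveRel r x z) (insert x (insert z {w | r w x})) := by
  have := hr.2.1
  have := hr.2.2
  have := hr.irrefl
  simp only [UpClosed, aboveRel, liftSet, Set.mem_insert_iff, Set.mem_ofPred_eq]
  grind

end SwapConstruction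

section Mixture

variable {n : ℕ} {A : Type*} [Fintype A] {a : A} {f : Prof n A → A → ℝ}

/-- With `a` first for everybody but `i`, the probability of a top choice `x ≠ a` of voter `i` does
not depend on anything else. -/
lemma apply_topRanked_const (hn : 3 ≤ n) (hf : IsSDS (WinnerDomain n a) f)
    (hsp : Strategyproof (WinnerDomain n a) f) (hpe : ExPostEfficient (WinnerDomain n a) f)
    {i : Fin n} {R R' : Prof n A} (hR : IsProf R) (hR' : IsProf R')
    (ha : ∀ j, j ≠ i → TopRanked (R j) a) (ha' : ∀ j, j ≠ i → TopRanked (R' j) a)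
    {x : A} (hx : TopRanked (R i) x) (hx' : TopRanked (R' i) x) (hxa : x ≠ a) :
    f R x = f R' x := by
  set r := liftSet {x} (liftSet {a} (R i)) with hr_def
  have hr : IsPref r := ((hR i).liftSet _).liftSet _
  have hrx : TopRanked r x := topRanked_liftSet_singleton _ _
  have hra : ∀ y, y ≠ a → y ≠ x → r a y := fun y hya hyx =>
    Or.inr ⟨by simp [hyx, hxa.symm], topRanked_liftSet_singleton _ _ y hya⟩
  have mem : ∀ {Q : Prof n A}, IsProf Q → (∀ j, j ≠ i → TopRanked (Q j) a) →
      Q ∈ WinnerDomain n a := fun hQ h => mem_winnerDomain_of_topRanked hn hQ i h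
  have upd : ∀ {Q : Prof n A}, (∀ j, j ≠ i → TopRanked (Q j) a) →
      ∀ j, j ≠ i → TopRanked (Function.update Q i r j) a := fun h j hj => by
    simpa [hj] using h j hj
  have norm : ∀ {Q : Prof n A}, IsProf Q → (∀ j, j ≠ i → TopRanked (Q j) a) →
      TopRanked (Q i) x → f Q x = f (Function.update Q i r) x := fun {Q} hQ h hQx => by
    refine hsp.apply_eq (i := i) WinnerDomain.isProf (mem hQ h) (mem (hQ.update hr i) (upd h))
      (fun j hj => by simp [hj]) fun w => ?_
    simp [(topRanked_iff (hQ i)).1 hQx w, (topRanked_iff hr).1 hrx w]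
  have compl : ∀ {Q : Prof n A}, IsProf Q → (∀ j, j ≠ i → TopRanked (Q j) a) →
      Q i = r → f Q x = 1 - f Q a := fun {Q} hQ h hQr => by
    have hm := mem hQ h
    have hsum := (hf Q hm).2
    rw [← Finset.add_sum_erase _ _ (Finset.mem_univ a),
      ← Finset.add_sum_erase (Finset.univ.erase a) _ (Finset.mem_erase.2 ⟨hxa, Finset.mem_univ x⟩),
      Finset.sum_eq_zero (s := (Finset.univ.erase a).erase x)] at hsum
    · linarith
    · intro y hy
      simp only [Finset.mem_erase, Finset.mem_univ, and_true] at hy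
      refine hpe Q hm a y fun j => ?_
      by_cases hj : j = i
      · subst hj; rw [hQr]; exact hra y hy.2 hy.1
      · exact h j hj y hy.2
  rw [norm hR ha hx, norm hR' ha' hx', compl (hR.update hr i) (upd ha) (by simp),
    compl (hR'.update hr i) (upd ha') (by simp)]
  congr 1
  refine eq_of_switch_one_by_one (fun Q => f Q a) _ _ fun Q j hQ hQj => ?_
  have hQp : IsProf Q := fun k => by
    rcases hQ k with h | h <;> rw [h]
    exacts [hR.update hr i k, hR'.update hr i k]
  have hQa : ∀ k, k ≠ i → TopRanked (Q k) a := fun k hk => by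
    rcases hQ k with h | h <;> rw [h]
    exacts [upd ha k hk, upd ha' k hk]
  by_cases hj : j = i
  · subst hj
    have : Function.update Q j (Function.update R' j r j) = Q := by
      simpa using hQj.symm
    rw [this]
  · refine hsp.apply_eq (i := j) WinnerDomain.isProf (mem hQp hQa)
      (mem (hQp.update (hR'.update hr i j) j) fun k hk => ?_) (fun k hk => by simp [hk])
      fun w => ?_
    · by_cases hkj : k = j
      · subst hkj; simpa using upd ha' k hk
      · simpa [hkj] using hQa k hk
    · have h₁ := (topRanked_iff (hQp j)).1 (hQa j hj) w
      have h₂ := (topRanked_iff (hR'.update hr i j)).1 (upd ha' j hj) w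
      simp only [Function.update_self, h₁, h₂]

/-- With `a` first for everybody but `i`, an alternative `y ≠ a` that voter `i` does not top-rank
gets probability zero. -/
lemma apply_eq_zero_of_not_topRanked (hn : 3 ≤ n) (hf : IsSDS (WinnerDomain n a) f)
    (hsp : Strategyproof (WinnerDomain n a) f) (hpe : ExPostEfficient (WinnerDomain n a) f)
    {i : Fin n} {R : Prof n A} (hR : IsProf R) (ha : ∀ j, j ≠ i → TopRanked (R j) a)
    {y : A} (hy : ¬ TopRanked (R i) y) (hya : y ≠ a) : f R y = 0 := by
  have mem : ∀ {Q : Prof n A}, IsProf Q → (∀ j, j ≠ i → TopRanked (Q j) a) →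
      Q ∈ WinnerDomain n a := fun hQ h => mem_winnerDomain_of_topRanked hn hQ i h
  have : Nonempty A := ⟨a⟩
  obtain ⟨x, hx⟩ := (hR i).exists_topRanked
  have hyx : y ≠ x := fun h => hy (h ▸ hx)
  by_cases hxa : x = a
  · subst hxa
    refine hpe R (mem hR ha) x y fun j => ?_
    by_cases hj : j = i
    · exact hj ▸ hx y hyx
    · exact ha j hj y hya
  let R' : Prof n A := fun j => if R j y x then aboveRel (R j) y x else R j
  have hR'p : ∀ j, IsPref (R' j) := fun j => by
    by_cases h : R j y x
    · simpa [R', h] using (hR j).aboveRel y x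
    · simpa [R', h] using hR j
  have hR'a : ∀ j, j ≠ i → TopRanked (R' j) a := fun j hj => by
    by_cases h : R j y x
    · simpa [R', h] using (ha j hj).aboveRel (z := x) (ha j hj y hya)
    · simpa [R', h] using ha j hj
  have hR'i : R' i = R i := if_neg ((hR i).2.2 _ _ (hx y hyx))
  have hR'xy : ∀ j, R' j x y := fun j => by
    by_cases h : R j y x
    · simpa [R', h] using aboveRel_apply (hR j) h
    · simpa [R', h] using ((hR j).1 y x hyx).resolve_left h
  rw [← hpe R' (mem hR'p hR'a) x y hR'xy]
  refine eq_of_switch_one_by_one (fun Q => f Q y) _ _ fun Q j hQ hQj => ?_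
  have hQp : IsProf Q := fun k => by
    rcases hQ k with h | h <;> rw [h]
    exacts [hR k, hR'p k]
  have hQa : ∀ k, k ≠ i → TopRanked (Q k) a := fun k hk => by
    rcases hQ k with h | h <;> rw [h]
    exacts [ha k hk, hR'a k hk]
  have hQi : Q i = R i := by rcases hQ i with h | h <;> simp [h, hR'i]
  by_cases h : R j y x
  swap
  · have : Function.update Q j (R' j) = Q := by simp [R', h, ← hQj]
    rw [this]
  have hj : j ≠ i := by
    rintro rfl
    exact (hR j).2.2 _ _ (hx y hyx) h
  have hR'j : R' j = aboveRel (R j) y x := if_pos h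
  have upda : ∀ {s}, TopRanked s a → ∀ k, k ≠ i → TopRanked (Function.update Q j s k) a := by
    intro s hs k hk
    by_cases hkj : k = j
    · subst hkj; simpa using hs
    · simpa [hkj] using hQa k hk
  have updi : ∀ s, Function.update Q j s i = R i := fun s => by simp [hj.symm, hQi]
  have hay : R j a y := ha j hj y hya
  have aB := upda ((ha j hj).belowRel (z := x) hay)
  have aT := upda ((ha j hj).aboveRel (z := x) hay)
  have m₀ := mem hQp hQa
  have m₁ := mem (hQp.update ((hR j).belowRel y x) j) aB
  have m₂ := mem (hQp.update ((hR j).aboveRel y x) j) aT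
  have e₁ : f Q y = f (Function.update Q j (belowRel (R j) y x)) y :=
    hsp.apply_eq (i := j) WinnerDomain.isProf m₀ m₁ (fun k hk => by simp [hk]) fun w => by
      simp [hQj, belowRel_apply_iff (hR j) h]
  have e₂ := hsp.apply_add_apply_eq (i := j) WinnerDomain.isProf m₁ m₂
    (fun k hk => by simp [hk]) (S := {w | R j w y}) hyx
    ((hR j).irrefl y) ((hR j).2.2 _ _ h)
    (by simpa using upClosed_above_belowRel (hR j))
    (by simpa using upClosed_above_aboveRel (hR j))
    (by simpa using upClosed_pair_belowRel _ _ _)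
    (by simpa using upClosed_pair_aboveRel (hR j))
  have e₃ := apply_topRanked_const hn hf hsp hpe m₁.1 m₂.1 aB aT
    (by rw [updi]; exact hx) (by rw [updi]; exact hx) hxa
  rw [hR'j, e₁]
  linarith

/-- With `a` first for everybody but `i`, the scheme only randomizes between `a` and the top choice
of voter `i`, with fixed probabilities. -/
lemma exists_weight (hn : 3 ≤ n) (hf : IsSDS (WinnerDomain n a) f)
    (hsp : Strategyproof (WinnerDomain n a) f) (hpe : ExPostEfficient (WinnerDomain n a) f)
    (hA : 3 ≤ Fintype.card A) (i : Fin n) :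
    ∃ c : ℝ, 0 ≤ c ∧ ∀ R : Prof n A, IsProf R → (∀ j, j ≠ i → TopRanked (R j) a) →
      ∀ x, x ≠ a → f R x = if TopRanked (R i) x then c else 0 := by
  obtain ⟨r₀, hr₀⟩ := IsPref.exists_finite (A := A)
  obtain ⟨b, hb⟩ : ∃ b, b ≠ a := Fintype.exists_ne_of_one_lt_card (by omega) a
  let P (r : A → A → Prop) : Prof n A := fun j => if j = i then r else liftSet {a} r₀
  have hP : ∀ r, IsPref r → IsProf (P r) := fun r hr j => by
    by_cases h : j = i
    · simpa [P, h] using hr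
    · simpa [P, h] using hr₀.liftSet _
  have hPa : ∀ r j, j ≠ i → TopRanked (P r j) a := fun r j hj => by
    simpa [P, hj] using topRanked_liftSet_singleton r₀ a
  have hPi : ∀ r, P r i = r := fun r => by simp [P]
  have hPm : ∀ r, IsPref r → P r ∈ WinnerDomain n a := fun r hr =>
    mem_winnerDomain_of_topRanked hn (hP r hr) i (hPa r)
  have hpb : IsPref (liftSet {b} r₀) := hr₀.liftSet _
  refine ⟨f (P (liftSet {b} r₀)) b, (hf _ (hPm _ hpb)).1 b, fun R hR ha x hxa => ?_⟩
  split_ifs with hx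
  swap
  · exact apply_eq_zero_of_not_topRanked hn hf hsp hpe hR ha hx hxa
  by_cases hxb : x = b
  · subst hxb
    exact apply_topRanked_const hn hf hsp hpe hR (hP _ hpb) ha (hPa _) hx
      (by rw [hPi]; exact topRanked_liftSet_singleton _ _) hxa
  have hp₁ : IsPref (liftSet {x} (liftSet {b} r₀)) := hpb.liftSet _
  have hp₂ : IsPref (liftSet {b} (liftSet {x} r₀)) := (hr₀.liftSet _).liftSet _
  have e := hsp.apply_add_apply_eq (i := i) WinnerDomain.isProf (hPm _ hp₁) (hPm _ hp₂)
    (fun j hj => by simp [P, hj]) (S := ∅) (x := x) (z := b) hxb (by simp) (by simp)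
    (by simp [UpClosed]) (by simp [UpClosed])
    (by rw [hPi]; simp only [UpClosed, liftSet, Set.mem_insert_iff, Set.mem_singleton_iff,
          Set.mem_empty_iff_false]; grind)
    (by rw [hPi]; simp only [UpClosed, liftSet, Set.mem_insert_iff, Set.mem_singleton_iff,
          Set.mem_empty_iff_false]; grind)
  have t₁ : TopRanked (P (liftSet {x} (liftSet {b} r₀)) i) x := by
    rw [hPi]; exact topRanked_liftSet_singleton _ _
  have t₂ : TopRanked (P (liftSet {b} (liftSet {x} r₀)) i) b := by
    rw [hPi]; exact topRanked_liftSet_singleton _ _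
  rw [apply_eq_zero_of_not_topRanked hn hf hsp hpe (hP _ hp₁) (hPa _) (y := b)
      (fun h => hxb ((hP _ hp₁ i).topRanked_unique t₁ h)) hb,
    apply_eq_zero_of_not_topRanked hn hf hsp hpe (hP _ hp₂) (hPa _) (y := x)
      (fun h => hxb ((hP _ hp₂ i).topRanked_unique h t₂)) hxa, add_zero, zero_add] at e
  rw [apply_topRanked_const hn hf hsp hpe hR (hP _ hp₁) ha (hPa _) hx t₁ hxa, e]
  exact apply_topRanked_const hn hf hsp hpe (hP _ hp₂) (hP _ hpb) (hPa _) (hPa _) t₂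
    (by rw [hPi]; exact topRanked_liftSet_singleton _ _) hb

/-- The effect on `x` of voter `i` swapping `x` and `z` is unchanged if another voter `j` moves
without changing the alternatives above `x`, or those above `z`. -/
lemma swap_gap_move (hsp : Strategyproof (WinnerDomain n a) f) {i j : Fin n} (hij : j ≠ i)
    {Q : Prof n A} {r s : A → A → Prop} {S : Set A} {x z : A} (hxz : x ≠ z) (hxS : x ∉ S)
    (hzS : z ∉ S) (h₁ : UpClosed (Q i) S) (h₁' : UpClosed r S)
    (h₂ : UpClosed (Q i) (insert x (insert z S))) (h₂' : UpClosed r (insert x (insert z S)))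
    (m₁ : Q ∈ WinnerDomain n a) (m₂ : Function.update Q i r ∈ WinnerDomain n a)
    (m₃ : Function.update Q j s ∈ WinnerDomain n a)
    (m₄ : Function.update (Function.update Q j s) i r ∈ WinnerDomain n a)
    (h : (∀ w, Q j w x ↔ s w x) ∨ (∀ w, Q j w z ↔ s w z)) :
    f Q x - f (Function.update Q i r) x =
      f (Function.update Q j s) x - f (Function.update (Function.update Q j s) i r) x := by
  have same : ∀ y, (∀ w, Q j w y ↔ s w y) → f Q y = f (Function.update Q j s) y ∧
      f (Function.update Q i r) y = f (Function.update (Function.update Q j s) i r) y := by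
    refine fun y hy => ⟨hsp.apply_eq (i := j) WinnerDomain.isProf m₁ m₃
      (fun k hk => by simp [hk]) (by simpa using hy), hsp.apply_eq (i := j) WinnerDomain.isProf
      m₂ m₄ (fun k hk => ?_) (by simpa [hij] using hy)⟩
    by_cases hki : k = i
    · subst hki; simp
    · simp [hki, hk]
  rcases h with h | h
  · rw [(same x h).1, (same x h).2]
  · have e₁ := hsp.apply_add_apply_eq (i := i) WinnerDomain.isProf m₁ m₂
      (fun k hk => by simp [hk]) hxz hxS hzS h₁ (by simpa using h₁') h₂ (by simpa using h₂')
    have e₂ := hsp.apply_add_apply_eq (i := i) WinnerDomain.isProf m₃ m₄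
      (fun k hk => by simp [hk]) hxz hxS hzS (by simpa [hij.symm] using h₁)
      (by simpa using h₁') (by simpa [hij.symm] using h₂) (by simpa using h₂')
    have := same z h
    linarith

/-- The effect on `x` of voter `i` swapping `x` and `z` is unchanged if everybody else moves `a` to
the top. -/
lemma swap_gap_lift (hsp : Strategyproof (WinnerDomain n a) f) {i : Fin n}
    {Q : Prof n A} {r : A → A → Prop} {S : Set A} {x z : A} (hxa : x ≠ a) (hza : z ≠ a)
    (hxz : x ≠ z) (hxS : x ∉ S)
    (hzS : z ∉ S) (h₁ : UpClosed (Q i) S) (h₁' : UpClosed r S)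
    (h₂ : UpClosed (Q i) (insert x (insert z S))) (h₂' : UpClosed r (insert x (insert z S)))
    (m₁ : Q ∈ WinnerDomain n a) (m₂ : Function.update Q i r ∈ WinnerDomain n a) :
    f Q x - f (Function.update Q i r) x =
      f (fun j => if j = i then Q j else liftSet {a} (Q j)) x -
      f (Function.update (fun j => if j = i then Q j else liftSet {a} (Q j)) i r) x := by
  have mem : ∀ P : Prof n A, P i = Q i → (∀ j, IsPref (P j)) →
      (∀ j y, Q j a y → P j a y) →
      P ∈ WinnerDomain n a ∧ Function.update P i r ∈ WinnerDomain n a := by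
    intro P hPi hP hup
    have hr : IsPref r := by simpa using m₂.1 i
    refine ⟨mem_winnerDomain_of_raise m₁ hP hup,
      mem_winnerDomain_of_raise m₂ (IsProf.update hP hr i) fun j y hy => ?_⟩
    by_cases hj : j = i
    · subst hj; simpa using hy
    · simp only [ne_eq, hj, not_false_eq_true, Function.update_of_ne] at hy ⊢
      exact hup j y hy
  have raise : ∀ (s : A → A → Prop) (T : Set A) y, a ∈ T → s a y → liftSet T s a y := by
    intro s T y haT h
    unfold liftSet; tauto
  refine eq_of_switch_one_by_one (fun P => f P x - f (Function.update P i r) x) _ _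
    fun P j hP hPj => ?_
  by_cases hj : j = i
  · subst hj
    have : Function.update P j (if j = j then Q j else liftSet {a} (Q j)) = P := by simp [← hPj]
    rw [this]
  have hPi : P i = Q i := by simpa using hP i
  have hPp : ∀ k, IsPref (P k) := fun k => by
    rcases hP k with h | h <;> rw [h]
    · exact m₁.1 k
    · split_ifs
      exacts [m₁.1 k, (m₁.1 k).liftSet _]
  have hPup : ∀ k y, Q k a y → P k a y := fun k y hy => by
    rcases hP k with h | h <;> rw [h]
    · exact hy
    · split_ifs
      exacts [hy, raise _ _ _ rfl hy]
  have memj : ∀ s, IsPref s → (∀ y, Q j a y → s a y) →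
      Function.update P j s ∈ WinnerDomain n a ∧
        Function.update (Function.update P j s) i r ∈ WinnerDomain n a := fun s hs hup => by
    refine mem _ (by simpa [Ne.symm hj] using hPi) (IsProf.update hPp hs j) fun k y hy => ?_
    by_cases hk : k = j
    · subst hk; simpa using hup y hy
    · simpa [hk] using hPup k y hy
  simp only [hj, if_false]
  obtain ⟨y, hy⟩ : ∃ y, (y = x ∧ Q j z x) ∨ (y = z ∧ Q j x z) := by
    rcases (m₁.1 j).1 x z hxz with h | h
    exacts [⟨z, Or.inr ⟨rfl, h⟩⟩, ⟨x, Or.inl ⟨rfl, h⟩⟩]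
  have hya : y ≠ a := by rcases hy with ⟨rfl, -⟩ | ⟨rfl, -⟩ <;> assumption
  set s := liftSet (insert a {w | Q j w y}) (Q j) with hs
  have hsp' : IsPref s := (m₁.1 j).liftSet _
  have upper : ∀ u, Q j u y → ∀ w, P j w u ↔ s w u := fun u hu w => by
    have := (m₁.1 j).2.1 w u y
    simp only [hPj, hs, liftSet, Set.mem_insert_iff, Set.mem_ofPred_eq]
    tauto
  have lower : ∀ w, s w y ↔ liftSet {a} (Q j) w y := fun w => by
    have := (m₁.1 j).irrefl y
    simp only [hs, liftSet, Set.mem_insert_iff, Set.mem_ofPred_eq, Set.mem_singleton_iff]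
    tauto
  obtain ⟨m₃, m₄⟩ := mem P hPi hPp hPup
  obtain ⟨m₅, m₆⟩ := memj s hsp' fun y => raise _ _ y (Or.inl rfl)
  obtain ⟨m₇, m₈⟩ := memj (liftSet {a} (Q j)) ((m₁.1 j).liftSet _) fun y => raise _ _ y rfl
  have e₁ := swap_gap_move hsp hj hxz hxS hzS (hPi ▸ h₁) h₁' (hPi ▸ h₂) h₂' m₃ m₄ m₅ m₆
    (by
      rcases hy with ⟨rfl, h⟩ | ⟨rfl, h⟩
      exacts [Or.inr (upper _ h), Or.inl (upper _ h)])
  have e₂ := swap_gap_move (Q := Function.update P j s) (s := liftSet {a} (Q j)) hsp hj hxz hxS hzS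
    (by simpa [Ne.symm hj, hPi] using h₁) h₁' (by simpa [Ne.symm hj, hPi] using h₂) h₂' m₅ m₆
    (by simpa using m₇) (by simpa using m₈)
    (by
      rcases hy with ⟨rfl, h⟩ | ⟨rfl, h⟩
      exacts [Or.inl (by simpa using lower), Or.inr (by simpa using lower)])
  rw [e₁, e₂]
  simp

/-- If `a` is first for everybody who prefers it to `x`, then letting voter `i` rank `z` above `x`
costs `x` precisely the weight of voter `i` if `x` was the top choice of `i`. -/
lemma exists_raise_above (hsp : Strategyproof (WinnerDomain n a) f)
    {x z : A} (hxa : x ≠ a) (hza : z ≠ a) (hxz : x ≠ z) {i : Fin n} {c : ℝ}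
    (hc : ∀ R : Prof n A, IsProf R → (∀ j, j ≠ i → TopRanked (R j) a) →
      f R x = if TopRanked (R i) x then c else 0)
    {Q : Prof n A} (hQ : Q ∈ WinnerDomain n a) (htop : ∀ j, Q j a x → TopRanked (Q j) a) :
    ∃ s, Function.update Q i s ∈ WinnerDomain n a ∧ (s a x → TopRanked s a) ∧ s z x ∧
      f Q x = f (Function.update Q i s) x + if TopRanked (Q i) x then c else 0 := by
  rcases (hQ.1 i).1 x z hxz with h | h
  swap
  · refine ⟨Q i, by simpa using hQ, htop i, h, ?_⟩
    rw [if_neg fun hx => (topRanked_iff (hQ.1 i)).1 hx z h]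
    simp
  have mem : ∀ s, IsPref s → (Q i a x → TopRanked s a) →
      Function.update Q i s ∈ WinnerDomain n a := fun s hs hsa => by
    refine mem_winnerDomain_of_support hQ (hQ.1.update hs i) fun y hy => ⟨x, hxa, fun j hj => ?_⟩
    by_cases hji : j = i
    · subst hji; simpa using hsa hj y hy
    · simpa [hji] using htop j hj y hy
  have hQi := hQ.1 i
  have m₁ := mem _ (hQi.belowRel x z) fun hax => (htop i hax).belowRel hax
  have m₂ := mem _ (hQi.aboveRel x z) fun hax => (htop i hax).aboveRel hax
  refine ⟨aboveRel (Q i) x z, m₂, fun hax => ?_, aboveRel_apply hQi h, ?_⟩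
  · have : Q i a x := by
      have := hQi.irrefl x
      simp only [aboveRel, liftSet, Set.mem_insert_iff, Set.mem_ofPred_eq] at hax
      grind
    exact (htop i this).aboveRel this
  have e₁ : f Q x = f (Function.update Q i (belowRel (Q i) x z)) x :=
    hsp.apply_eq (i := i) WinnerDomain.isProf hQ m₁ (fun k hk => by simp [hk]) fun w => by
      simp [belowRel_apply_iff hQi h]
  have e₂ := swap_gap_lift (i := i) (r := aboveRel (Q i) x z) (S := {w | Q i w x}) hsp hxa hza hxz
    (hQi.irrefl x) (hQi.2.2 _ _ h)
    (by simpa using upClosed_above_belowRel hQi) (upClosed_above_aboveRel hQi)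
    (by simpa using upClosed_pair_belowRel _ _ _) (upClosed_pair_aboveRel hQi) m₁
    (by simpa using m₂)
  set P : Prof n A := fun j => if j = i then Function.update Q i (belowRel (Q i) x z) j else
    liftSet {a} (Function.update Q i (belowRel (Q i) x z) j)
  have hP : IsProf P := fun j => by
    by_cases hj : j = i
    · simpa [P, hj] using hQi.belowRel x z
    · simpa [P, hj] using (hQ.1 j).liftSet _
  have hPa : ∀ j, j ≠ i → TopRanked (P j) a := fun j hj => by
    simpa [P, hj] using topRanked_liftSet_singleton (Q j) a
  have t₁ : TopRanked (P i) x ↔ TopRanked (Q i) x :=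
    topRanked_congr (hP i) hQi fun w => by simp [P, belowRel_apply_iff hQi h]
  have t₂ : ¬ TopRanked (aboveRel (Q i) x z) x := fun hx =>
    (topRanked_iff (hQi.aboveRel x z)).1 hx z (aboveRel_apply hQi h)
  rw [hc P hP hPa, hc _ (hP.update (hQi.aboveRel x z) i) fun j hj => by simpa [hj] using hPa j hj]
    at e₂
  simp only [t₁, Function.update_self, t₂, Function.update_idem, if_false] at e₂
  rw [e₁]
  linarith

lemma apply_eq_sum_weights (hA : 3 ≤ Fintype.card A)
    (hsp : Strategyproof (WinnerDomain n a) f) (hpe : ExPostEfficient (WinnerDomain n a) f)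
    {c : Fin n → ℝ}
    (hc : ∀ i, ∀ R : Prof n A, IsProf R → (∀ j, j ≠ i → TopRanked (R j) a) →
      ∀ x, x ≠ a → f R x = if TopRanked (R i) x then c i else 0)
    {R : Prof n A} (hR : R ∈ WinnerDomain n a) {x : A} (hxa : x ≠ a) :
    f R x = ∑ i, if TopRanked (R i) x then c i else 0 := by
  obtain ⟨z, hz⟩ : ∃ z, z ∉ ({a, x} : Finset A) := by
    by_contra! h
    have h₁ : Fintype.card A ≤ _ := Finset.card_le_card fun z (_ : z ∈ Finset.univ) => h z
    have h₂ := Finset.card_le_two (a := a) (b := x)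
    omega
  simp only [Finset.mem_insert, Finset.mem_singleton, not_or] at hz
  have key : ∀ (s : Finset (Fin n)) (Q : Prof n A), Q ∈ WinnerDomain n a →
      (∀ j, Q j a x → TopRanked (Q j) a) → ∃ Q' ∈ WinnerDomain n a,
        (∀ j, Q' j a x → TopRanked (Q' j) a) ∧ (∀ j ∈ s, Q' j z x) ∧ (∀ j ∉ s, Q' j = Q j) ∧
        f Q x = f Q' x + ∑ j ∈ s, if TopRanked (Q j) x then c j else 0 := by
    intro s Q hQ htop
    induction s using Finset.induction_on with
    | empty => exact ⟨Q, hQ, htop, by simp, by simp, by simp⟩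
    | insert i s hi ih =>
      obtain ⟨Q', hQ', htop', hs, hns, e⟩ := ih
      obtain ⟨r, hr, hra, hrz, e'⟩ := exists_raise_above (i := i) hsp hxa hz.1 (Ne.symm hz.2)
        (fun R hR ha => hc i R hR ha x hxa) hQ' htop'
      refine ⟨Function.update Q' i r, hr, fun j => ?_, fun j hj => ?_, fun j hj => ?_, ?_⟩
      · by_cases hji : j = i
        · subst hji; simpa using hra
        · simpa [hji] using htop' j
      · by_cases hji : j = i
        · subst hji; simpa using hrz
        · simpa [hji] using hs j ((Finset.mem_insert.1 hj).resolve_left hji)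
      · rw [Finset.mem_insert, not_or] at hj
        simpa [hj.1] using hns j hj.2
      · rw [Finset.sum_insert hi, e, e', hns i hi]
        ring
  let Q : Prof n A := fun j => if R j a x then liftSet {a} (R j) else R j
  have hraise : ∀ j y, R j a y → liftSet {a} (R j) a y := fun j y hy =>
    topRanked_liftSet_singleton _ _ y fun h => (hR.1 j).irrefl a (h ▸ hy)
  have hQj : ∀ j, IsPref (Q j) := fun j => by
    unfold Q; split_ifs
    exacts [(hR.1 j).liftSet _, hR.1 j]
  have hQ : Q ∈ WinnerDomain n a := mem_winnerDomain_of_raise hR hQj fun j y hy => by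
    unfold Q; split_ifs
    exacts [hraise j y hy, hy]
  have hQx : ∀ j w, R j w x ↔ Q j w x := fun j w => by
    unfold Q; split_ifs with h
    · simp only [liftSet, Set.mem_singleton_iff]
      grind
    · rfl
  obtain ⟨Q', hQ', -, hzx, -, e⟩ := key Finset.univ Q hQ fun j hj => by
    have h := (hQx j a).2 hj
    simpa [Q, h] using topRanked_liftSet_singleton (R j) a
  rw [hpe Q' hQ' z x fun j => hzx j (Finset.mem_univ j), zero_add] at e
  have e' : f R x = f Q x := by
    refine eq_of_switch_one_by_one (fun P => f P x) R Q fun P i hP hPi => ?_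
    have hPj : ∀ j, IsPref (P j) ∧ ∀ y, R j a y → P j a y := fun j => by
      rcases hP j with h | h <;> rw [h]
      · exact ⟨hR.1 j, fun y => id⟩
      · refine ⟨hQj j, fun y hy => ?_⟩
        unfold Q; split_ifs
        exacts [hraise j y hy, hy]
    refine hsp.apply_eq (i := i) WinnerDomain.isProf
      (mem_winnerDomain_of_raise hR (fun j => (hPj j).1) fun j => (hPj j).2)
      (mem_winnerDomain_of_raise hR (IsProf.update (fun j => (hPj j).1) (hQj i) i) fun j y hy => ?_)
      (fun k hk => by simp [hk]) fun w => by simpa [hPi] using hQx i w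
    by_cases hj : j = i
    · subst hj
      rw [Function.update_self]
      unfold Q; split_ifs
      exacts [hraise j y hy, hy]
    · simpa [hj] using (hPj j).2 y hy
  rw [e', e]
  exact Finset.sum_congr rfl fun j _ => by
    rw [topRanked_congr (hQj j) (hR.1 j) fun w => (hQx j w).symm]

lemma sum_dict [Nonempty A] {R : Prof n A} (hR : IsProf R) (i : Fin n) : ∑ x, dict i R x = 1 := by
  obtain ⟨t, ht⟩ := (hR i).exists_topRanked
  unfold dict
  rw [Finset.sum_eq_single t (fun y _ hy => if_neg fun h => hy ((hR i).topRanked_unique h ht))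
    (by simp)]
  exact if_pos ht

end Mixture

/-- On a super Condorcet domain, every strategyproof and ex post efficient SDS
is, on `D_C^a`, a (possibly signed) mixture of the Condorcet rule and a random dictatorship. -/
theorem sds_on_DCa_mixture {n : ℕ} {A : Type*} [Fintype A]
    (hn : 3 ≤ n) (hA : 3 ≤ Fintype.card A)
    (D : Set (Prof n A)) (hDprof : ∀ R ∈ D, IsProf R)
    (hDC : CondorcetDomain n A ⊆ D)
    (f : Prof n A → A → ℝ) (hf : IsSDS D f)
    (hsp : Strategyproof D f) (hppe : ExPostEfficient D f)
    (a : A) :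
    ∃ (γC : ℝ) (γ : Fin n → ℝ), (∀ i, 0 ≤ γ i) ∧ γC + ∑ i, γ i = 1 ∧
      ∀ R : Prof n A, IsProf R → CondorcetWinner R a →
        ∀ x, f R x = γC * CondRule R x + ∑ i, γ i * dict i R x := by
  have hsub : WinnerDomain n a ⊆ D := fun R hR => hDC ⟨hR.1, a, hR.2⟩
  have hf' : IsSDS (WinnerDomain n a) f := fun R hR => hf R (hsub hR)
  have hsp' : Strategyproof (WinnerDomain n a) f := fun R hR R' hR' =>
    hsp R (hsub hR) R' (hsub hR')
  have hpe' : ExPostEfficient (WinnerDomain n a) f := fun R hR => hppe R (hsub hR)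
  have : Nonempty A := ⟨a⟩
  choose c hc₀ hc using exists_weight hn hf' hsp' hpe' hA
  refine ⟨1 - ∑ i, c i, c, hc₀, by ring, fun R hR hRa x => ?_⟩
  have off : ∀ x, x ≠ a → f R x =
      (1 - ∑ i, c i) * CondRule R x + ∑ i, c i * dict i R x := fun x hx => by
    rw [apply_eq_sum_weights hA hsp' hpe' hc ⟨hR, hRa⟩ hx, CondRule,
      if_neg fun h => hx (condorcetWinner_unique h hRa)]
    simp [dict]
  by_cases hx : x = a
  swap
  · exact off x hx
  subst hx
  have hcond : ∑ y, CondRule R y = 1 := by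
    unfold CondRule
    rw [Finset.sum_eq_single x (fun y _ hy => if_neg fun h => hy (condorcetWinner_unique h hRa))
      (by simp)]
    exact if_pos hRa
  have hrhs : ∑ y, ((1 - ∑ i, c i) * CondRule R y + ∑ i, c i * dict i R y) = 1 := by
    rw [Finset.sum_add_distrib, ← Finset.mul_sum, hcond, Finset.sum_comm]
    simp [← Finset.mul_sum, sum_dict hR]
  have hsum := (hf' R ⟨hR, hRa⟩).2
  rw [← Finset.add_sum_erase _ _ (Finset.mem_univ x)] at hsum hrhs
  rw [Finset.sum_congr rfl fun y hy => off y (Finset.ne_of_mem_erase hy)] at hsum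
  linarith
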